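/- Let ρ₁ > 0, ρ₂ > 0, m₀ > 0, u₂ < u₀ < u₁ and ρ₁ ≠ ρ₂ be real constants, and let x₁(t) = [(ρ₁u₁−ρ₂u₂)t + m₀ − √(f(t))]/(ρ₁−ρ₂) with f(t) = ρ₁ρ₂(u₁−u₂)²t² + 2m₀[ρ₁(u₁−u₀) − ρ₂(u₂−u₀)]t + m₀². Then the piston's velocity converges: lim_{t→∞} x₁'(t) = [−√(ρ₁ρ₂)(u₁−u₂) + ρ₁u₁ − ρ₂u₂]/(ρ₁−ρ₂) = (√ρ₁·u₁ + √ρ₂·u₂)/(√ρ₁ + √ρ₂). -/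

import Mathlib

open Filter Topology

/-- The normalized quadratic `a + b / t + c / t ^ 2` tends to its leading coefficient. -/
lemma tendsto_add_inv_add_inv_sq (a b c : ℝ) :
    Tendsto (fun t : ℝ => a + b * t⁻¹ + c * t⁻¹ ^ 2) atTop (𝓝 a) := by
  have hinv : Tendsto (fun t : ℝ => t⁻¹) atTop (𝓝 0) := tendsto_inv_atTop_zero
  simpa using ((hinv.const_mul b).const_add a).add ((hinv.pow 2).const_mul c)

/-- A quadratic with positive leading coefficient is eventually positive. -/
lemma eventually_quadratic_pos {a : ℝ} (ha : 0 < a) (b c : ℝ) :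
    ∀ᶠ t : ℝ in atTop, 0 < a * t ^ 2 + b * t + c := by
  filter_upwards [(tendsto_add_inv_add_inv_sq a b c).eventually_const_lt ha,
    eventually_gt_atTop 0] with t hq ht
  have h : a * t ^ 2 + b * t + c = t ^ 2 * (a + b * t⁻¹ + c * t⁻¹ ^ 2) := by
    field_simp
  rw [h]
  positivity

lemma hasDerivAt_sqrt_quadratic {a b c t : ℝ} (h : 0 < a * t ^ 2 + b * t + c) :
    HasDerivAt (fun s : ℝ => √(a * s ^ 2 + b * s + c))
      ((2 * a * t + b) / (2 * √(a * t ^ 2 + b * t + c))) t := by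
  have hq : HasDerivAt (fun s : ℝ => a * s ^ 2 + b * s + c) (2 * a * t + b) t := by
    refine (((((hasDerivAt_id' t).pow 2).const_mul a).add
      ((hasDerivAt_id' t).const_mul b)).add_const c).congr_deriv ?_
    norm_num
    ring
  exact hq.sqrt (ne_of_gt h)

/-- The slope of `√(a t ^ 2 + b t + c)` tends to `√a`. -/
lemma tendsto_slope_sqrt_quadratic {a : ℝ} (ha : 0 < a) (b c : ℝ) :
    Tendsto (fun t : ℝ => (2 * a * t + b) / (2 * √(a * t ^ 2 + b * t + c))) atTop
      (𝓝 √a) := by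
  have hnum : Tendsto (fun t : ℝ => 2 * a + b * t⁻¹) atTop (𝓝 (2 * a)) := by
    simpa using tendsto_add_inv_add_inv_sq (2 * a) b 0
  have hden : Tendsto (fun t : ℝ => 2 * √(a + b * t⁻¹ + c * t⁻¹ ^ 2)) atTop
      (𝓝 (2 * √a)) :=
    (tendsto_add_inv_add_inv_sq a b c).sqrt.const_mul 2
  have hlim := hnum.div hden (by positivity)
  rw [mul_div_mul_left _ _ two_ne_zero, Real.div_sqrt] at hlim
  refine hlim.congr' ?_
  filter_upwards [eventually_gt_atTop 0] with t ht
  have hq : a * t ^ 2 + b * t + c = t ^ 2 * (a + b * t⁻¹ + c * t⁻¹ ^ 2) := by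
    field_simp
  have hn : 2 * a * t + b = t * (2 * a + b * t⁻¹) := by
    field_simp
  rw [hq, Real.sqrt_mul (sq_nonneg t), Real.sqrt_sq ht.le, hn, mul_left_comm 2 t,
    mul_div_mul_left _ _ ht.ne']
  rfl

/-- Case 1 (`ρ₁ ≠ ρ₂`): the piston's velocity converges, as `t → ∞`, to
`[−√(ρ₁ρ₂)(u₁−u₂) + ρ₁u₁ − ρ₂u₂]/(ρ₁−ρ₂) = (√ρ₁·u₁ + √ρ₂·u₂)/(√ρ₁ + √ρ₂)`. -/
theorem piston_limit_velocity (ρ₁ ρ₂ m₀ u₀ u₁ u₂ : ℝ)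
    (hρ₁ : 0 < ρ₁) (hρ₂ : 0 < ρ₂) (hm₀ : 0 < m₀)
    (h₂₀ : u₂ < u₀) (h₀₁ : u₀ < u₁) (hne : ρ₁ ≠ ρ₂)
    (f x₁ : ℝ → ℝ)
    (hf : ∀ t : ℝ, f t =
      ρ₁ * ρ₂ * (u₁ - u₂) ^ 2 * t ^ 2
        + 2 * m₀ * (ρ₁ * (u₁ - u₀) - ρ₂ * (u₂ - u₀)) * t + m₀ ^ 2)
    (hx : ∀ t : ℝ, x₁ t =
      ((ρ₁ * u₁ - ρ₂ * u₂) * t + m₀ - Real.sqrt (f t)) / (ρ₁ - ρ₂)) :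
    Filter.Tendsto (deriv x₁) Filter.atTop
      (nhds ((-Real.sqrt (ρ₁ * ρ₂) * (u₁ - u₂) + ρ₁ * u₁ - ρ₂ * u₂) / (ρ₁ - ρ₂))) ∧
    (-Real.sqrt (ρ₁ * ρ₂) * (u₁ - u₂) + ρ₁ * u₁ - ρ₂ * u₂) / (ρ₁ - ρ₂) =
      (Real.sqrt ρ₁ * u₁ + Real.sqrt ρ₂ * u₂) / (Real.sqrt ρ₁ + Real.sqrt ρ₂) := by
  have hu : 0 < u₁ - u₂ := by linarith
  constructor
  · have ha : 0 < ρ₁ * ρ₂ * (u₁ - u₂) ^ 2 := by positivity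
    have hsqrt : √(ρ₁ * ρ₂ * (u₁ - u₂) ^ 2) = √(ρ₁ * ρ₂) * (u₁ - u₂) := by
      rw [Real.sqrt_mul (by positivity), Real.sqrt_sq hu.le]
    have hlim := ((tendsto_slope_sqrt_quadratic ha
      (2 * m₀ * (ρ₁ * (u₁ - u₀) - ρ₂ * (u₂ - u₀))) (m₀ ^ 2)).const_sub
      (ρ₁ * u₁ - ρ₂ * u₂)).div_const (ρ₁ - ρ₂)
    have hval : -√(ρ₁ * ρ₂) * (u₁ - u₂) + ρ₁ * u₁ - ρ₂ * u₂ =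
        ρ₁ * u₁ - ρ₂ * u₂ - √(ρ₁ * ρ₂ * (u₁ - u₂) ^ 2) := by
      rw [hsqrt]
      ring
    rw [hval]
    refine hlim.congr' ?_
    filter_upwards [eventually_quadratic_pos ha
      (2 * m₀ * (ρ₁ * (u₁ - u₀) - ρ₂ * (u₂ - u₀))) (m₀ ^ 2)] with t ht
    have hlin : HasDerivAt (fun s : ℝ => (ρ₁ * u₁ - ρ₂ * u₂) * s + m₀)
        (ρ₁ * u₁ - ρ₂ * u₂) t := by
      simpa using ((hasDerivAt_id t).const_mul (ρ₁ * u₁ - ρ₂ * u₂)).add_const m₀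
    have hx' : x₁ = fun s => ((ρ₁ * u₁ - ρ₂ * u₂) * s + m₀ -
        √(ρ₁ * ρ₂ * (u₁ - u₂) ^ 2 * s ^ 2 +
          2 * m₀ * (ρ₁ * (u₁ - u₀) - ρ₂ * (u₂ - u₀)) * s + m₀ ^ 2)) / (ρ₁ - ρ₂) := by
      funext s
      rw [hx, hf]
    rw [hx']
    exact ((hlin.sub (hasDerivAt_sqrt_quadratic ht)).div_const (ρ₁ - ρ₂)).deriv.symm
  · have h₁ : 0 < √ρ₁ := Real.sqrt_pos.2 hρ₁
    have h₂ : 0 < √ρ₂ := Real.sqrt_pos.2 hρ₂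
    rw [div_eq_div_iff (sub_ne_zero.2 hne) (by positivity), Real.sqrt_mul hρ₁.le]
    have e₁ : ρ₁ = √ρ₁ ^ 2 := (Real.sq_sqrt hρ₁.le).symm
    have e₂ : ρ₂ = √ρ₂ ^ 2 := (Real.sq_sqrt hρ₂.le).symm
    linear_combination (√ρ₂ * u₁ - √ρ₂ * u₂) * e₁ + (√ρ₁ * u₁ - √ρ₁ * u₂) * e₂
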